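/- Let X be a compact geodesic metric space with more than one point, and let 𝓑 := {B ∈ NonemptyCompacts X | ∃ x ∈ X, ∃ ε ≥ 0, (B : Set X) = Metric.closedBall x ε} be the set of all closed metric balls, viewed as a subset of the hyperspace. Then: (1) 𝓑 is a compact (hence closed) subset of NonemptyCompacts X; (2) 𝓑 is positively invariant under the semiflow: for every B ∈ 𝓑 and t ≥ 0, the set Metric.cthickening t B again belongs to 𝓑; (3) 𝓑 is contractible: there is a continuous map H : 𝓑 × [0,1] → 𝓑 with H(B,0) = B for all B and H(B,1) equal to the point of the hyperspace corresponding to the whole space X for all B. -/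

import Mathlib

/-- A metric space is geodesic if any two points are joined by a geodesic path. -/
def IsGeodesicMetricSpace (X : Type*) [MetricSpace X] : Prop :=
  ∀ x y : X, ∃ γ : ℝ → X, γ 0 = x ∧ γ (dist x y) = y ∧
    ∀ s ∈ Set.Icc (0 : ℝ) (dist x y), ∀ t ∈ Set.Icc (0 : ℝ) (dist x y),
      dist (γ s) (γ t) = |s - t|

/-- The subset `𝓑` of the hyperspace consisting of all closed metric balls. -/
def ballSubspace (X : Type*) [MetricSpace X] :
    Set (TopologicalSpace.NonemptyCompacts X) :=
  {B | ∃ x : X, ∃ ε : ℝ, 0 ≤ ε ∧ (B : Set X) = Metric.closedBall x ε}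

open Metric TopologicalSpace
open scoped NNReal

/-- In a geodesic space, a pair at distance at most `s + t` has a point within `s` of the first
and within `t` of the second. -/
theorem IsGeodesicMetricSpace.exists_dist_le_dist_le {X : Type*} [MetricSpace X]
    (hgeo : IsGeodesicMetricSpace X) {x z : X} {s t : ℝ} (hs : 0 ≤ s) (ht : 0 ≤ t)
    (h : dist x z ≤ s + t) : ∃ w, dist x w ≤ s ∧ dist w z ≤ t := by
  obtain ⟨γ, hγ0, hγ1, hγ⟩ := hgeo x z
  have hm : min s (dist x z) ∈ Set.Icc 0 (dist x z) :=
    ⟨le_min hs dist_nonneg, min_le_right _ _⟩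
  have h0 := hγ 0 ⟨le_rfl, dist_nonneg⟩ _ hm
  have h1 := hγ _ hm _ ⟨dist_nonneg, le_rfl⟩
  rw [hγ0, zero_sub, abs_neg, abs_of_nonneg hm.1] at h0
  rw [hγ1, abs_sub_comm, abs_of_nonneg (sub_nonneg.2 hm.2)] at h1
  refine ⟨_, h0.trans_le (min_le_left _ _), h1.trans_le ?_⟩
  rcases min_cases s (dist x z) with h' | h' <;> linarith [h'.1]

theorem IsGeodesicMetricSpace.cthickening_closedBall {X : Type*} [MetricSpace X] [ProperSpace X]
    (hgeo : IsGeodesicMetricSpace X) (x : X) {ε t : ℝ} (hε : 0 ≤ ε) (ht : 0 ≤ t) :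
    cthickening t (closedBall x ε) = closedBall x (ε + t) := by
  ext z
  rw [isClosed_closedBall.cthickening_eq_biUnion_closedBall ht]
  simp only [Set.mem_iUnion, mem_closedBall, exists_prop]
  constructor
  · rintro ⟨w, hw, hz⟩
    linarith [dist_triangle z w x]
  · intro hz
    obtain ⟨w, hxw, hwz⟩ := hgeo.exists_dist_le_dist_le hε ht (dist_comm z x ▸ hz)
    exact ⟨w, dist_comm x w ▸ hxw, dist_comm w z ▸ hwz⟩

/-- The closed thickening of a nonempty compact subset of a proper space. -/
def TopologicalSpace.NonemptyCompacts.closedThickening {X : Type*} [MetricSpace X] [ProperSpace X]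
    (t : ℝ≥0) (A : NonemptyCompacts X) : NonemptyCompacts X where
  carrier := cthickening t (A : Set X)
  isCompact' := A.isCompact.cthickening
  nonempty' := A.nonempty.mono (self_subset_cthickening _)

namespace IsGeodesicMetricSpace

variable {X : Type*} [MetricSpace X] [ProperSpace X]

theorem exists_mem_closedThickening_dist_le (hgeo : IsGeodesicMetricSpace X) (s t : ℝ≥0)
    (A B : NonemptyCompacts X) {z : X} (hz : z ∈ (A.closedThickening s : Set X)) :
    ∃ w ∈ (B.closedThickening t : Set X), dist z w ≤ dist A B + dist s t := by
  change z ∈ cthickening s (A : Set X) at hz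
  rw [A.isCompact.cthickening_eq_biUnion_closedBall s.coe_nonneg] at hz
  simp only [Set.mem_iUnion, mem_closedBall, exists_prop] at hz
  obtain ⟨a, ha, hza⟩ := hz
  obtain ⟨b, hb, hab⟩ := B.isCompact.exists_infDist_eq_dist B.nonempty a
  have hd : infDist a (B : Set X) ≤ dist A B :=
    infDist_le_hausdorffDist_of_mem ha (hausdorffEDist_ne_top_of_nonempty_of_bounded A.nonempty
      B.nonempty A.isCompact.isBounded B.isCompact.isBounded)
  have hst : (s : ℝ) - t ≤ dist s t := le_abs_self _
  obtain ⟨w, hzw, hwb⟩ := hgeo.exists_dist_le_dist_le (x := z) (z := b)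
    (add_nonneg dist_nonneg dist_nonneg : 0 ≤ dist A B + dist s t) t.coe_nonneg
    (by linarith [dist_triangle z a b])
  exact ⟨w, mem_cthickening_of_dist_le w b t B hb hwb, hzw⟩

theorem dist_closedThickening_le (hgeo : IsGeodesicMetricSpace X) (s t : ℝ≥0)
    (A B : NonemptyCompacts X) :
    dist (A.closedThickening s) (B.closedThickening t) ≤ dist A B + dist s t := by
  refine hausdorffDist_le_of_mem_dist (add_nonneg dist_nonneg dist_nonneg)
    (fun z hz ↦ hgeo.exists_mem_closedThickening_dist_le s t A B hz) (fun z hz ↦ ?_)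
  rw [dist_comm A B, dist_comm s t]
  exact hgeo.exists_mem_closedThickening_dist_le t s B A hz

theorem continuous_closedThickening (hgeo : IsGeodesicMetricSpace X) :
    Continuous fun p : ℝ≥0 × NonemptyCompacts X ↦ p.2.closedThickening p.1 := by
  refine (LipschitzWith.of_dist_le_mul (K := 2) fun p q ↦ ?_).continuous
  have h := hgeo.dist_closedThickening_le p.1 q.1 p.2 q.2
  have h1 : dist p.1 q.1 ≤ dist p q := le_max_left _ _
  have h2 : dist p.2 q.2 ≤ dist p q := le_max_right _ _
  push_cast
  linarith

theorem closedThickening_mem_ballSubspace (hgeo : IsGeodesicMetricSpace X) (t : ℝ≥0)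
    {B : NonemptyCompacts X} (hB : B ∈ ballSubspace X) :
    B.closedThickening t ∈ ballSubspace X := by
  obtain ⟨x, ε, hε, hB⟩ := hB
  refine ⟨x, ε + t, add_nonneg hε t.coe_nonneg, ?_⟩
  change cthickening t (B : Set X) = _
  rw [hB, hgeo.cthickening_closedBall x hε t.coe_nonneg]

end IsGeodesicMetricSpace

theorem cthickening_diam_univ {X : Type*} [MetricSpace X] [CompactSpace X] {s : Set X}
    (hs : s.Nonempty) : cthickening (diam (Set.univ : Set X)) s = Set.univ := by
  obtain ⟨a, ha⟩ := hs
  exact Set.eq_univ_of_forall fun z ↦ mem_cthickening_of_dist_le z a _ s ha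
    (dist_le_diam_of_mem isCompact_univ.isBounded trivial trivial)

theorem IsGeodesicMetricSpace.isCompact_ballSubspace {X : Type*} [MetricSpace X] [CompactSpace X]
    (hgeo : IsGeodesicMetricSpace X) : IsCompact (ballSubspace X) := by
  let D : ℝ≥0 := ⟨diam (Set.univ : Set X), diam_nonneg⟩
  have hsing : Continuous fun x : X ↦ ({x} : NonemptyCompacts X) :=
    NonemptyCompacts.isometry_singleton.continuous
  have hcont : Continuous fun p : ℝ≥0 × X ↦ ({p.2} : NonemptyCompacts X).closedThickening p.1 :=
    hgeo.continuous_closedThickening.comp (g := fun p : ℝ≥0 × NonemptyCompacts X ↦ _)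
      (f := fun p : ℝ≥0 × X ↦ (p.1, ({p.2} : NonemptyCompacts X)))
      (continuous_fst.prodMk (hsing.comp continuous_snd))
  have hcoe (t : ℝ≥0) (x : X) :
      (({x} : NonemptyCompacts X).closedThickening t : Set X) = closedBall x t :=
    cthickening_singleton x t.coe_nonneg
  convert ((isCompact_Icc (a := 0) (b := D)).prod (isCompact_univ (X := X))).image hcont using 1
  ext B
  constructor
  · rintro ⟨x, ε, hε, hB⟩
    lift ε to ℝ≥0 using hε
    refine ⟨(min ε D, x), ⟨⟨zero_le, min_le_right _ _⟩, trivial⟩, SetLike.coe_injective ?_⟩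
    rw [hcoe, hB]
    ext z
    have hz : dist z x ≤ D := dist_le_diam_of_mem isCompact_univ.isBounded trivial trivial
    simp [hz]
  · rintro ⟨⟨t, x⟩, -, rfl⟩
    exact ⟨x, t, t.coe_nonneg, hcoe t x⟩

/-- For a compact geodesic metric space `X` with more than one point, the dynamical cone
`𝓑` of all closed balls is: (1) compact in the hyperspace; (2) positively invariant
under the semiflow `π(A,t) = cthickening t A`; and (3) contractible to the point of the
hyperspace corresponding to the whole space `X`. -/
theorem ballSubspace_compact_posInvariant_contractible
    {X : Type*} [MetricSpace X] [CompactSpace X] [Nontrivial X]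
    (hgeo : IsGeodesicMetricSpace X) :
    IsCompact (ballSubspace X) ∧
    (∀ B ∈ ballSubspace X, ∀ t : ℝ, 0 ≤ t →
      ∃ x : X, ∃ ε : ℝ, 0 ≤ ε ∧
        Metric.cthickening t (B : Set X) = Metric.closedBall x ε) ∧
    (∃ H : ballSubspace X × Set.Icc (0 : ℝ) 1 → ballSubspace X,
      Continuous H ∧
      (∀ B : ballSubspace X, H (B, ⟨0, by norm_num⟩) = B) ∧
      (∀ B : ballSubspace X,
        ((H (B, ⟨1, by norm_num⟩) : TopologicalSpace.NonemptyCompacts X) : Set X) =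
          Set.univ)) := by
  refine ⟨hgeo.isCompact_ballSubspace, fun B hB t ht ↦
    hgeo.closedThickening_mem_ballSubspace ⟨t, ht⟩ hB, ?_⟩
  let D : ℝ≥0 := ⟨diam (Set.univ : Set X), diam_nonneg⟩
  refine ⟨fun p ↦ ⟨(p.1 : NonemptyCompacts X).closedThickening (Real.toNNReal p.2 * D),
    hgeo.closedThickening_mem_ballSubspace _ p.1.2⟩, ?_, fun B ↦ ?_, fun B ↦ ?_⟩
  · have hparam : Continuous fun p : ballSubspace X × Set.Icc (0 : ℝ) 1 ↦
        (Real.toNNReal p.2 * D, (p.1 : NonemptyCompacts X)) := by fun_prop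
    exact (hgeo.continuous_closedThickening.comp hparam).subtype_mk _
  · refine Subtype.ext (SetLike.coe_injective ?_)
    change cthickening ((Real.toNNReal 0 * D : ℝ≥0) : ℝ) (B.1 : Set X) = B.1
    simp [B.1.isCompact.isClosed.closure_eq]
  · change cthickening ((Real.toNNReal 1 * D : ℝ≥0) : ℝ) (B.1 : Set X) = Set.univ
    rw [Real.toNNReal_one, one_mul]
    exact cthickening_diam_univ B.1.nonempty
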